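/- Let N ≥ 3 be an integer, r = sqrt((N−1)/(2N)), and u_j = 2 sin(πj/N) for 1 ≤ j ≤ N−1. For every integer i with 0 ≤ i ≤ N−1, the quantity P_i^{(2)} = r^{−2}·∑_{j=1}^{⌊(N−1)/2⌋} u_j^{−2}·(2u_j² − 2 + 2cos(2πij/N)) + c_N(i), where c_N(i) = (2r)^{−2}·((−1)^i + 3) if N is even and c_N(i) = 0 if N is odd, satisfies P_i^{(2)} = (2−i)·N + (i² − i)·N/(N−1). -/

import Mathlib

open Real Finset

lemma aux_fold (f : ℕ → ℝ) (N : ℕ) (hN : 3 ≤ N)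
    (hf : ∀ j, 1 ≤ j → j ≤ N - 1 → f (N - j) = f j) :
    ∑ j ∈ Finset.range (N - 1), f (j + 1) =
      2 * ∑ j ∈ Finset.Icc 1 ((N - 1) / 2), f j + (if Even N then f (N / 2) else 0) := by
  have hI : ∀ m : ℕ, ∑ j ∈ Finset.Icc 1 m, f j = ∑ j ∈ Finset.range m, f (j + 1) := by
    intro m
    induction m with
    | zero => simp
    | succ k ih => rw [Finset.sum_Icc_succ_top (by omega), ih, Finset.sum_range_succ]
  rw [hI]
  rcases Nat.even_or_odd N with h | h
  · obtain ⟨m, hm⟩ := h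
    have h1 : N - 1 = (m - 1) + (1 + (m - 1)) := by omega
    have h2 : (N - 1) / 2 = m - 1 := by omega
    have h3 : N / 2 = m := by omega
    have he : Even N := ⟨m, hm⟩
    rw [h2, h3, if_pos he, h1, Finset.sum_range_add, Finset.sum_range_add,
      ← Finset.sum_range_reflect (fun x => f (m - 1 + (1 + x) + 1))]
    have : ∑ j ∈ Finset.range (m - 1), f (m - 1 + (1 + (m - 1 - 1 - j)) + 1) =
        ∑ j ∈ Finset.range (m - 1), f (j + 1) := by
      apply Finset.sum_congr rfl
      intro j hj
      rw [Finset.mem_range] at hj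
      rw [← hf (j + 1) (by omega) (by omega)]
      congr 1
      omega
    rw [this]
    have h4 : m - 1 + 0 + 1 = m := by omega
    simp only [Finset.sum_range_one, h4]
    ring
  · have hne : ¬ Even N := by rwa [Nat.not_even_iff_odd]
    obtain ⟨m, hm⟩ := h
    have h1 : N - 1 = m + m := by omega
    have h2 : (N - 1) / 2 = m := by omega
    rw [h2, if_neg hne, h1, Finset.sum_range_add,
      ← Finset.sum_range_reflect (fun x => f (m + x + 1))]
    have : ∑ j ∈ Finset.range m, f (m + (m - 1 - j) + 1) =
        ∑ j ∈ Finset.range m, f (j + 1) := by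
      apply Finset.sum_congr rfl
      intro j hj
      rw [Finset.mem_range] at hj
      rw [← hf (j + 1) (by omega) (by omega)]
      congr 1
      omega
    rw [this]
    ring

lemma aux_cos (N k : ℕ) (hk : 1 ≤ k) (hkN : k < N) :
    ∑ j ∈ Finset.range (N - 1), Real.cos (2 * k * (π * ((j + 1 : ℕ) : ℝ) / N)) = -1 := by
  have hN0 : (0 : ℝ) < N := by exact_mod_cast (by omega : 0 < N)
  have hk0 : (0 : ℝ) < k := by exact_mod_cast (by omega : 0 < k)
  have hkN' : (k : ℝ) < N := by exact_mod_cast hkN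
  set a : ℝ := π * k / N with ha
  have hs : 0 < Real.sin a := by
    apply Real.sin_pos_of_pos_of_lt_pi
    · positivity
    · rw [ha, div_lt_iff₀ hN0]
      exact mul_lt_mul_of_pos_left hkN' Real.pi_pos
  have tele : ∀ M : ℕ, 2 * Real.sin a *
      ∑ j ∈ Finset.range M, Real.cos (2 * k * (π * ((j + 1 : ℕ) : ℝ) / N)) =
      Real.sin ((2 * M + 1) * a) - Real.sin a := by
    intro M
    induction M with
    | zero => simp
    | succ M ih =>
      rw [Finset.sum_range_succ, mul_add, ih]
      have e1 : 2 * (k : ℝ) * (π * ((M + 1 : ℕ) : ℝ) / N) = 2 * (M + 1) * a := by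
        rw [ha]; push_cast; ring
      have e2 : (2 * (M : ℝ) + 1) * a = 2 * (M + 1) * a - a := by ring
      have e3 : (2 * ((M + 1 : ℕ) : ℝ) + 1) * a = 2 * (M + 1) * a + a := by push_cast; ring
      rw [e1, e2, e3, Real.sin_add, Real.sin_sub]
      ring
  have h := tele (N - 1)
  have e : (2 * ((N - 1 : ℕ) : ℝ) + 1) * a = k * (2 * π) - a := by
    rw [Nat.cast_sub (by omega), ha]
    field_simp
    push_cast
    ring
  rw [e, Real.sin_nat_mul_two_pi_sub] at h
  have : Real.sin a * (∑ j ∈ Finset.range (N - 1),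
      Real.cos (2 * k * (π * ((j + 1 : ℕ) : ℝ) / N)) + 1) = 0 := by linarith
  rcases mul_eq_zero.mp this with h | h
  · exact absurd h hs.ne'
  · linarith

lemma aux_sin (N : ℕ) (j : ℕ) (h1 : 1 ≤ j) (h2 : j < N) : 0 < Real.sin (π * j / N) := by
  have hN0 : (0 : ℝ) < N := by exact_mod_cast (by omega : 0 < N)
  have hj0 : (0 : ℝ) < j := by exact_mod_cast (by omega : 0 < j)
  apply Real.sin_pos_of_pos_of_lt_pi
  · positivity
  · rw [div_lt_iff₀ hN0]
    exact mul_lt_mul_of_pos_left (by exact_mod_cast h2) Real.pi_pos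

lemma aux_T (N : ℕ) (hN : 3 ≤ N) (i : ℕ) : i + 1 < N + 1 →
    (∑ j ∈ Finset.range (N - 1), (1 - Real.cos (2 * i * (π * ((j + 1 : ℕ) : ℝ) / N))) /
      (2 * Real.sin (π * ((j + 1 : ℕ) : ℝ) / N) ^ 2) = N * i - (i : ℝ) ^ 2) := by
  induction i using Nat.twoStepInduction with
  | zero => intro _; simp
  | one =>
    intro _
    have : ∀ j ∈ Finset.range (N - 1),
        (1 - Real.cos (2 * (1 : ℕ) * (π * ((j + 1 : ℕ) : ℝ) / N))) /
      (2 * Real.sin (π * ((j + 1 : ℕ) : ℝ) / N) ^ 2) = 1 := by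
      intro j hj
      rw [Finset.mem_range] at hj
      have := aux_sin N (j + 1) (by omega) (by omega)
      rw [Nat.cast_one, mul_one, Real.cos_two_mul, Real.cos_sq']
      field_simp
      ring
    rw [Finset.sum_congr rfl this]
    simp [Nat.cast_sub (by omega : 1 ≤ N)]
  | more i ih0 ih1 =>
    intro hi
    have h0 := ih0 (by omega)
    have h1 := ih1 (by omega)
    have hc := aux_cos N (i + 1) (by omega) (by omega)
    have : ∀ j ∈ Finset.range (N - 1),
        (1 - Real.cos (2 * (i + 2 : ℕ) * (π * ((j + 1 : ℕ) : ℝ) / N))) /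
      (2 * Real.sin (π * ((j + 1 : ℕ) : ℝ) / N) ^ 2) =
        2 * ((1 - Real.cos (2 * (i + 1 : ℕ) * (π * ((j + 1 : ℕ) : ℝ) / N))) /
      (2 * Real.sin (π * ((j + 1 : ℕ) : ℝ) / N) ^ 2)) -
        ((1 - Real.cos (2 * i * (π * ((j + 1 : ℕ) : ℝ) / N))) /
      (2 * Real.sin (π * ((j + 1 : ℕ) : ℝ) / N) ^ 2)) +
        2 * Real.cos (2 * (i + 1 : ℕ) * (π * ((j + 1 : ℕ) : ℝ) / N)) := by
      intro j hj
      rw [Finset.mem_range] at hj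
      have hs := aux_sin N (j + 1) (by omega) (by omega)
      set x := π * ((j + 1 : ℕ) : ℝ) / N
      have e1 : 2 * ((i + 2 : ℕ) : ℝ) * x = 2 * (i + 1 : ℕ) * x + 2 * x := by push_cast; ring
      have e2 : 2 * (i : ℝ) * x = 2 * (i + 1 : ℕ) * x - 2 * x := by push_cast; ring
      rw [e1, e2, Real.cos_add, Real.cos_sub, Real.cos_two_mul x, Real.cos_sq']
      field_simp
      ring
    rw [Finset.sum_congr rfl this, Finset.sum_add_distrib, Finset.sum_sub_distrib,
      ← Finset.mul_sum, ← Finset.mul_sum, h0, h1, hc]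
    push_cast
    ring

/-- For `N ≥ 3`, with `r = sqrt((N-1)/(2N))` and `u_j = 2 sin(πj/N)`, the radial
Hessian block value
`P_i^{(2)} = r⁻²·∑_{j=1}^{⌊(N-1)/2⌋} u_j⁻²·(2u_j² - 2 + 2cos(2πij/N)) + c_N(i)`
(with `c_N(i) = (2r)⁻²·((-1)^i + 3)` for even `N`, `0` for odd `N`) equals
`(2-i)·N + (i² - i)·N/(N-1)` for every `0 ≤ i ≤ N-1`. -/
theorem vortex_P_diagonal_value
    (N : ℕ) (hN : 3 ≤ N) (r : ℝ) (hr : r = Real.sqrt ((N - 1) / (2 * N)))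
    (u : ℕ → ℝ) (hu : ∀ j, u j = 2 * Real.sin (π * j / N))
    (i : ℕ) (hi : i ≤ N - 1) :
    r ^ (-2 : ℤ) *
        ∑ j ∈ Finset.Icc 1 ((N - 1) / 2),
          u j ^ (-2 : ℤ) * (2 * u j ^ 2 - 2 + 2 * Real.cos (2 * π * i * j / N)) +
      (if Even N then (2 * r) ^ (-2 : ℤ) * ((-1 : ℝ) ^ i + 3) else 0) =
    (2 - (i : ℝ)) * N + ((i : ℝ) ^ 2 - i) * N / ((N : ℝ) - 1) := by
  have hN0 : (0 : ℝ) < N := by exact_mod_cast (by omega : 0 < N)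
  have hN1 : (0 : ℝ) < (N : ℝ) - 1 := by
    have : (3 : ℝ) ≤ N := by exact_mod_cast hN
    linarith
  have hr2 : r ^ 2 = (N - 1) / (2 * N) := by
    rw [hr, Real.sq_sqrt (by positivity)]
  have hz : ∀ x : ℝ, x ^ (-2 : ℤ) = (x ^ 2)⁻¹ := fun x => by
    rw [zpow_neg]; norm_cast
  simp only [hz, mul_pow, hr2]
  set f : ℕ → ℝ := fun j =>
    (u j ^ 2)⁻¹ * (2 * u j ^ 2 - 2 + 2 * Real.cos (2 * π * i * j / N)) with hfdef
  have hsym : ∀ j, 1 ≤ j → j ≤ N - 1 → f (N - j) = f j := by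
    intro j h1 h2
    have hu' : u (N - j) = u j := by
      rw [hu, hu, Nat.cast_sub (by omega), ← Real.sin_pi_sub (π * j / N)]
      congr 2
      field_simp
    have hc : Real.cos (2 * π * i * ((N - j : ℕ) : ℝ) / N) = Real.cos (2 * π * i * j / N) := by
      rw [Nat.cast_sub (by omega), ← Real.cos_nat_mul_two_pi_sub (2 * π * i * j / N) i]
      congr 1
      field_simp
    simp only [hfdef, hu', hc]
  have hfold := aux_fold f N hN hsym
  have hT := aux_T N hN i (by omega)
  have hsum : ∑ j ∈ Finset.range (N - 1), f (j + 1) = 2 * (N - 1) - (N * i - (i : ℝ) ^ 2) := by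
    rw [← hT]
    have : ∀ j ∈ Finset.range (N - 1), f (j + 1) =
        2 - (1 - Real.cos (2 * i * (π * ((j + 1 : ℕ) : ℝ) / N))) /
      (2 * Real.sin (π * ((j + 1 : ℕ) : ℝ) / N) ^ 2) := by
      intro j hj
      rw [Finset.mem_range] at hj
      have hs := aux_sin N (j + 1) (by omega) (by omega)
      have e : 2 * π * i * ((j + 1 : ℕ) : ℝ) / N = 2 * i * (π * ((j + 1 : ℕ) : ℝ) / N) := by ring
      simp only [hfdef, hu, e]
      field_simp
      ring
    rw [Finset.sum_congr rfl this, Finset.sum_sub_distrib]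
    simp [Nat.cast_sub (by omega : 1 ≤ N)]
    ring
  rw [hsum] at hfold
  have hmid : Even N → f (N / 2) = (3 + (-1 : ℝ) ^ i) / 2 := by
    rintro ⟨m, hm⟩
    have h3 : N / 2 = m := by omega
    have hm0 : (0 : ℝ) < m := by exact_mod_cast (by omega : 0 < m)
    have hNm : (N : ℝ) = m + m := by exact_mod_cast hm
    have e1 : π * m / N = π / 2 := by rw [hNm]; field_simp; ring
    have e2 : 2 * π * i * m / N = i * π := by rw [hNm]; field_simp; ring
    simp only [hfdef, h3, hu, e1, e2, Real.sin_pi_div_two, Real.cos_nat_mul_pi]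
    ring
  by_cases he : Even N
  · rw [if_pos he, hmid he] at hfold
    rw [if_pos he]
    have : ∑ j ∈ Finset.Icc 1 ((N - 1) / 2), f j =
      (2 * (N - 1) - (N * i - (i : ℝ) ^ 2) - (3 + (-1 : ℝ) ^ i) / 2) / 2 := by linarith
    rw [this]
    field_simp
    ring
  · rw [if_neg he] at hfold
    rw [if_neg he]
    have : ∑ j ∈ Finset.Icc 1 ((N - 1) / 2), f j =
      (2 * (N - 1) - (N * i - (i : ℝ) ^ 2)) / 2 := by linarith
    rw [this]
    field_simp
    ring
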